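/- Let q ≥ 2 and n ≥ 1. (i) Every expansive automata network f : [q]^n → [q]^n satisfies Φ(f) ≤ (q−1)·q^{n−1}/(q^n − 1). (ii) If q is a prime power, there exists an expansive field linear network f : GF(q)^n → GF(q)^n (namely the q-ary image of multiplication by a primitive element of GF(q^n)) with Φ(f) = (q−1)·q^{n−1}/(q^n − 1). -/

import Mathlib

/-- An automata network `f` is *expansive* if for all distinct configurations `x, y`
and every node `v` there exists `t ≥ 1` with `f^t(x)_v ≠ f^t(y)_v`. -/
def Expansive {m : ℕ} {α : Type*} (f : (Fin m → α) → (Fin m → α)) : Prop :=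
  ∀ x y : Fin m → α, x ≠ y → ∀ v : Fin m, ∃ t : ℕ, 1 ≤ t ∧ f^[t] x v ≠ f^[t] y v

/-- `l_x`: the length of the orbit of `x` under `f`, i.e. its least period. -/
noncomputable def orbitLen {m : ℕ} {α : Type*} (f : (Fin m → α) → (Fin m → α))
    (x : Fin m → α) : ℕ :=
  sInf {l : ℕ | 1 ≤ l ∧ f^[l] x = x}

/-- `φ_v(x,y)`: the proportion of times `1 ≤ t ≤ l_x · l_y` at which
`f^t(x)_v ≠ f^t(y)_v`. -/
noncomputable def phiFreq {m : ℕ} {α : Type*} (f : (Fin m → α) → (Fin m → α))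
    (v : Fin m) (x y : Fin m → α) : ℝ :=
  (Set.ncard {t : ℕ | 1 ≤ t ∧ t ≤ orbitLen f x * orbitLen f y ∧ f^[t] x v ≠ f^[t] y v} : ℝ)
    / (orbitLen f x * orbitLen f y : ℕ)

/-- The expansion frequency `Φ(f)`: the minimum of `φ_v(x,y)` over all nodes `v` and
all pairs of distinct configurations `x, y`. -/
noncomputable def Phi {m : ℕ} {α : Type*} (f : (Fin m → α) → (Fin m → α)) : ℝ :=
  sInf {r : ℝ | ∃ (v : Fin m) (x y : Fin m → α), x ≠ y ∧ r = phiFreq f v x y}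

open Finset Function in
/-- The frequency `phiFreq` may be computed over any common period of the network. -/
theorem phiFreq_eq_of_iterate_eq_id {m : ℕ} {α : Type*} [DecidableEq α]
    {f : (Fin m → α) → (Fin m → α)} {N : ℕ} (hN : 0 < N) (hf : f^[N] = id)
    (v : Fin m) (x y : Fin m → α) :
    phiFreq f v x y = (#{t ∈ range N | f^[t] x v ≠ f^[t] y v} : ℝ) / N := by
  have key (z : Fin m → α) : 0 < orbitLen f z ∧ f^[orbitLen f z] z = z :=
    Nat.sInf_mem (s := {l : ℕ | 1 ≤ l ∧ f^[l] z = z}) ⟨N, hN, by simp [hf]⟩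
  obtain ⟨hx, hx'⟩ := key x
  obtain ⟨hy, hy'⟩ := key y
  unfold phiFreq
  set L := orbitLen f x * orbitLen f y with hL
  have hLpos : 0 < L := Nat.mul_pos hx hy
  have hLx : f^[L] x = x := (IsPeriodicPt.mul_const (f := f) hx' _ :)
  have hLy : f^[L] y = y := (IsPeriodicPt.const_mul (f := f) hy' _ :)
  let p : ℕ → Prop := fun t => f^[t] x v ≠ f^[t] y v
  have hpN : Periodic p N := fun t => by simp [p, iterate_add_apply, hf]
  have hpL : Periodic p L := fun t => by simp [p, iterate_add_apply, hLx, hLy]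
  have hset : {t : ℕ | 1 ≤ t ∧ t ≤ L ∧ f^[t] x v ≠ f^[t] y v}
      = ((Ico 1 (1 + L)).filter p : Finset ℕ) := by
    ext t
    simp only [Set.mem_ofPred_eq, coe_filter, mem_Ico, p]
    rw [and_assoc, Nat.lt_one_add_iff]
  rw [hset, Set.ncard_coe_finset, Nat.filter_Ico_card_eq_of_periodic _ _ _ hpL]
  have hmul (a b : ℕ) (h : Periodic p a) : Nat.count p (b * a) = b * Nat.count p a := by
    induction b with
    | zero => simp
    | succ b ih =>
      rw [Nat.succ_mul, Nat.count_add, ih, Nat.succ_mul]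
      congr 2
      funext t
      rw [add_comm]
      exact (h.nat_mul b) t
  have h1 := hmul L N hpL
  have h2 := hmul N L hpN
  rw [← Nat.count_eq_card_filter_range]
  have h3 : N * Nat.count p L = L * Nat.count p N := by rw [← h1, ← h2, mul_comm]
  rw [div_eq_div_iff (by positivity) (by positivity)]
  have h4 : (N : ℝ) * Nat.count p L = L * Nat.count p N := by exact_mod_cast h3
  linarith

open Finset in
theorem Fintype.card_filter_apply_ne {ι α : Type*} [Fintype ι] [DecidableEq ι] [Fintype α]
    [DecidableEq α] (v : ι) (a : α) :
    #{z : ι → α | a ≠ z v} = Fintype.card α ^ Fintype.card ι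
      - Fintype.card α ^ (Fintype.card ι - 1) := by
  have h := card_filter_piFinset_const (univ : Finset α) v a
  rw [if_pos (mem_univ _), piFinset_univ, card_univ] at h
  have h' := card_filter_add_card_filter_not (s := (univ : Finset (ι → α))) (fun z => z v = a)
  rw [h, card_univ, Fintype.card_fun] at h'
  have hfilter : ({z | a ≠ z v} : Finset (ι → α)) = ({z | ¬ z v = a} : Finset (ι → α)) :=
    filter_congr fun z _ => ne_comm
  rw [hfilter]
  exact Nat.eq_sub_of_add_eq' h'

theorem cast_pow_sub_pow_pred {n : ℕ} (hn : 1 ≤ n) {q : ℕ} (hq : 1 ≤ q) :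
    ((q ^ n - q ^ (n - 1) : ℕ) : ℝ) = ((q : ℝ) - 1) * (q : ℝ) ^ (n - 1) := by
  rw [Nat.cast_sub (Nat.pow_le_pow_right hq (Nat.sub_le _ _))]
  obtain ⟨m, rfl⟩ := Nat.exists_eq_add_of_le' hn
  push_cast
  ring

theorem phiFreq_nonneg {m : ℕ} {α : Type*} (f : (Fin m → α) → (Fin m → α)) (v : Fin m)
    (x y : Fin m → α) : 0 ≤ phiFreq f v x y :=
  div_nonneg (Nat.cast_nonneg _) (Nat.cast_nonneg _)

theorem Phi_le_phiFreq {m : ℕ} {α : Type*} (f : (Fin m → α) → (Fin m → α)) (v : Fin m)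
    {x y : Fin m → α} (h : x ≠ y) : Phi f ≤ phiFreq f v x y := by
  refine csInf_le ⟨0, ?_⟩ ⟨v, x, y, h, rfl⟩
  rintro _ ⟨v, x, y, -, rfl⟩
  exact phiFreq_nonneg f v x y

theorem Expansive.injective {m : ℕ} (hm : 1 ≤ m) {α : Type*} {f : (Fin m → α) → (Fin m → α)}
    (hf : Expansive f) : Function.Injective f := by
  intro x y hxy
  by_contra hne
  obtain ⟨t, ht, h⟩ := hf x y hne ⟨0, hm⟩
  obtain ⟨s, rfl⟩ := Nat.exists_eq_add_of_le' ht
  simp [Function.iterate_succ_apply, hxy] at h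

theorem Function.Injective.exists_iterate_eq_id {β : Type*} [Finite β] {f : β → β}
    (hf : Function.Injective f) : ∃ N, 0 < N ∧ f^[N] = id := by
  let σ : Equiv.Perm β := Equiv.ofBijective f (Finite.injective_iff_bijective.mp hf)
  refine ⟨orderOf σ, orderOf_pos σ, ?_⟩
  change (σ : β → β)^[orderOf σ] = id
  rw [Equiv.Perm.iterate_eq_pow, pow_orderOf_eq_one, Equiv.Perm.coe_one]

open Finset in
/-- The expansion frequency is at most the average of `phiFreq f v x y` over `y ≠ x`. -/
theorem Expansive.Phi_le {n : ℕ} (hn : 1 ≤ n) {q : ℕ} (hq : 2 ≤ q)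
    {f : (Fin n → Fin q) → (Fin n → Fin q)} (hf : Expansive f) :
    Phi f ≤ ((q : ℝ) - 1) * (q : ℝ) ^ (n - 1) / ((q : ℝ) ^ n - 1) := by
  have hinj := hf.injective hn
  obtain ⟨N, hN, hfN⟩ := hinj.exists_iterate_eq_id
  let v : Fin n := ⟨0, hn⟩
  let x : Fin n → Fin q := fun _ => ⟨0, by omega⟩
  have hcard : (#(univ.erase x) : ℝ) = (q : ℝ) ^ n - 1 := by
    rw [card_erase_of_mem (mem_univ x), card_univ, Fintype.card_fun, Fintype.card_fin,
      Fintype.card_fin, Nat.cast_sub (Nat.one_le_pow _ _ (by omega))]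
    simp
  have hpos : 0 < (q : ℝ) ^ n - 1 := by
    have : 1 < q ^ n := Nat.one_lt_pow (by omega) (by omega)
    have : (1 : ℝ) < (q : ℝ) ^ n := by exact_mod_cast this
    linarith
  have hcount (t : ℕ) : #{y | f^[t] x v ≠ f^[t] y v} = q ^ n - q ^ (n - 1) := by
    have hb : Function.Bijective f^[t] := Finite.injective_iff_bijective.mp (hinj.iterate t)
    have h := Fintype.card_filter_apply_ne v (f^[t] x v)
    rw [Fintype.card_fin, Fintype.card_fin] at h
    rw [← h]
    refine card_bijective _ hb ?_
    simp
  have hsum : ∑ y ∈ univ.erase x, phiFreq f v x y = ((q : ℝ) - 1) * (q : ℝ) ^ (n - 1) := by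
    rw [sum_erase]
    · simp_rw [phiFreq_eq_of_iterate_eq_id hN hfN]
      rw [← sum_div, ← Nat.cast_sum]
      have := sum_card_bipartiteAbove_eq_sum_card_bipartiteBelow
        (s := (univ : Finset (Fin n → Fin q))) (t := range N) (fun y t => f^[t] x v ≠ f^[t] y v)
      simp only [bipartiteAbove, bipartiteBelow] at this
      rw [this, sum_congr rfl fun t _ => hcount t, sum_const, card_range, smul_eq_mul,
        Nat.cast_mul, cast_pow_sub_pow_pred hn (by omega)]
      field_simp
    · simp [phiFreq]
  rw [le_div_iff₀ hpos, ← hsum, ← hcard, mul_comm, ← nsmul_eq_mul]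
  exact card_nsmul_le_sum _ _ _ fun y hy => Phi_le_phiFreq f v (ne_of_mem_erase hy).symm

open Finset in
/-- Multiplication by a primitive element of the degree-`n` extension of `F`, written in an
`F`-basis, is an expansive network for which all pairs have the same frequency. -/
theorem exists_expansive_vecMul_Phi_eq {n : ℕ} (hn : 1 ≤ n) (F : Type) [Field F] [Fintype F] :
    ∃ M : Matrix (Fin n) (Fin n) F,
      Expansive (fun x => Matrix.vecMul x M) ∧
      Phi (fun x => Matrix.vecMul x M) =
        ((Fintype.card F : ℝ) - 1) * (Fintype.card F : ℝ) ^ (n - 1)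
          / ((Fintype.card F : ℝ) ^ n - 1) := by
  classical
  have : NeZero n := ⟨by omega⟩
  obtain ⟨p, hp⟩ := CharP.exists F
  have : Fact p.Prime := ⟨CharP.char_is_prime F p⟩
  let E := FiniteField.Extension F p n
  have hrank : Module.finrank F E = n := FiniteField.finrank_extension F p n
  let _ : Fintype E := Fintype.ofFinite E
  have hE : Fintype.card E = Fintype.card F ^ n := by
    have h := FiniteField.natCard_extension F p n
    rwa [Nat.card_eq_fintype_card, Nat.card_eq_fintype_card] at h
  let e : E ≃ₗ[F] (Fin n → F) := (Module.finBasisOfFinrankEq F E hrank).equivFun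
  obtain ⟨g, hg⟩ := IsCyclic.exists_generator (α := Eˣ)
  let A : (Fin n → F) →ₗ[F] (Fin n → F) :=
    e.toLinearMap ∘ₗ LinearMap.mulLeft F (g : E) ∘ₗ e.symm.toLinearMap
  let M : Matrix (Fin n) (Fin n) F := (LinearMap.toMatrix' A).transpose
  have hM : (fun x => Matrix.vecMul x M) = A := by
    funext x
    rw [Matrix.vecMul_transpose, LinearMap.toMatrix'_mulVec]
  have hA (t : ℕ) (x : Fin n → F) : A^[t] x = e ((g : E) ^ t * e.symm x) := by
    induction t with
    | zero => simp
    | succ t ih =>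
      rw [Function.iterate_succ_apply', ih]
      simp [A, pow_succ', mul_assoc]
  set N := Fintype.card F ^ n - 1 with hNdef
  have hNcard : Nat.card Eˣ = N := by
    rw [Nat.card_units, Nat.card_eq_fintype_card, hE]
  have hord : orderOf g = N := by rw [orderOf_eq_card_of_forall_mem_zpowers hg, hNcard]
  have hN : 0 < N := hord ▸ orderOf_pos g
  have hAN : A^[N] = id := by
    funext x
    rw [hA, ← hord, ← Units.val_pow_eq_pow_val, pow_orderOf_eq_one]
    simp
  have hcount (v : Fin n) {x y : Fin n → F} (hxy : x ≠ y) :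
      #{t ∈ range N | A^[t] x v ≠ A^[t] y v}
        = Fintype.card F ^ n - Fintype.card F ^ (n - 1) := by
    have h := Fintype.card_filter_apply_ne v (0 : F)
    rw [Fintype.card_fin] at h
    rw [← h]
    have hw : e.symm (x - y) ≠ 0 := by simpa [sub_eq_zero] using hxy
    have hdiff (t : ℕ) : A^[t] x - A^[t] y = e ((g : E) ^ t * e.symm (x - y)) := by
      rw [hA, hA, ← map_sub, ← mul_sub, ← map_sub]
    refine card_bij (fun t _ => A^[t] x - A^[t] y) ?_ ?_ ?_
    · intro t ht
      simpa [sub_eq_zero, eq_comm (a := (0 : F))] using (mem_filter.mp ht).2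
    · intro s hs t ht hst
      rw [hdiff, hdiff] at hst
      have h1 := mul_right_cancel₀ hw (e.injective hst)
      have h2 : g ^ s = g ^ t := Units.ext (by simpa using h1)
      refine pow_injOn_Iio_orderOf ?_ ?_ h2
      · simpa [hord] using (mem_filter.mp hs).1
      · simpa [hord] using (mem_filter.mp ht).1
    · intro z hz
      have hzv : 0 ≠ z v := (mem_filter.mp hz).2
      have hz0 : e.symm z ≠ 0 := by
        intro h0
        apply hzv
        rw [(LinearEquiv.map_eq_zero_iff _).mp h0, Pi.zero_apply]
      have hmem : Units.mk0 _ hz0 / Units.mk0 _ hw ∈ image (g ^ ·) (range (Nat.card Eˣ)) := by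
        rw [IsCyclic.image_range_card hg]
        exact mem_univ _
      obtain ⟨t, ht, hgt⟩ := mem_image.mp hmem
      have hz' : A^[t] x - A^[t] y = z := by
        rw [hdiff, ← Units.val_pow_eq_pow_val, hgt, Units.val_div_eq_div_val, Units.val_mk0,
          Units.val_mk0, div_mul_cancel₀ _ hw, e.apply_symm_apply]
      refine ⟨t, mem_filter.mpr ⟨hNcard ▸ ht, ?_⟩, hz'⟩
      intro heq
      apply hzv
      rw [← hz', Pi.sub_apply, heq, sub_self]
  have hq : 2 ≤ Fintype.card F := Fintype.one_lt_card
  have hphi (v : Fin n) {x y : Fin n → F} (hxy : x ≠ y) : phiFreq A v x y =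
      ((Fintype.card F : ℝ) - 1) * (Fintype.card F : ℝ) ^ (n - 1)
          / ((Fintype.card F : ℝ) ^ n - 1) := by
    rw [phiFreq_eq_of_iterate_eq_id hN hAN, hcount v hxy, cast_pow_sub_pow_pred hn (by omega),
      hNdef, Nat.cast_sub (Nat.one_le_pow _ _ (by omega))]
    simp
  refine ⟨M, ?_⟩
  rw [hM]
  constructor
  · intro x y hxy v
    have hlt : 0 < #{t ∈ range N | A^[t] x v ≠ A^[t] y v} := by
      rw [hcount v hxy]
      have := Nat.pow_lt_pow_right (a := Fintype.card F) (by omega) (Nat.sub_lt hn one_pos)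
      omega
    obtain ⟨t, ht⟩ := card_pos.mp hlt
    refine ⟨t + N, by omega, ?_⟩
    simpa [Function.iterate_add_apply, hAN] using (mem_filter.mp ht).2
  · have hset : {r : ℝ | ∃ (v : Fin n) (x y : Fin n → F), x ≠ y ∧ r = phiFreq A v x y}
        = {((Fintype.card F : ℝ) - 1) * (Fintype.card F : ℝ) ^ (n - 1)
          / ((Fintype.card F : ℝ) ^ n - 1)} := by
      ext r
      constructor
      · rintro ⟨v, x, y, hxy, rfl⟩
        exact hphi v hxy
      · rintro rfl
        obtain ⟨x, y, hxy⟩ := exists_pair_ne (Fin n → F)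
        exact ⟨0, x, y, hxy, (hphi 0 hxy).symm⟩
    rw [Phi, hset, csInf_singleton]

/-- Theorem: (i) every expansive network `f : [q]^n → [q]^n` satisfies
`Φ(f) ≤ (q-1) q^{n-1} / (qⁿ - 1)`; (ii) if `q` is a prime power (i.e. `q` is the order
of a finite field `F`), there is an expansive field linear network over `F` attaining
this bound with equality. -/
theorem stmt_15 (n : ℕ) (hn : 1 ≤ n) :
    (∀ q : ℕ, 2 ≤ q → ∀ f : (Fin n → Fin q) → (Fin n → Fin q), Expansive f →
      Phi f ≤ ((q : ℝ) - 1) * (q : ℝ) ^ (n - 1) / ((q : ℝ) ^ n - 1)) ∧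
    (∀ (F : Type) [Field F] [Fintype F],
      ∃ M : Matrix (Fin n) (Fin n) F,
        Expansive (fun x => Matrix.vecMul x M) ∧
        Phi (fun x => Matrix.vecMul x M) =
          ((Fintype.card F : ℝ) - 1) * (Fintype.card F : ℝ) ^ (n - 1)
            / ((Fintype.card F : ℝ) ^ n - 1)) := by
  exact ⟨fun _ hq _ hf => hf.Phi_le hn hq, fun F _ _ => exists_expansive_vecMul_Phi_eq hn F⟩
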